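/- arXiv:2211.15277 — 2 statements merged into one kernel-verified Lean document; each statement's English description precedes it below -/
import Mathlib

section
/- Let 𝔇_n^+ = {π ∈ 𝔇_n : π_n > 0} and D_n^+(s,t,q) = Σ_{π∈𝔇_n^+} s^{edes_D(π)} t^{odes_D(π)} q^{inv_D(π)}. For even integers n ≥ 2, D_n^+(s,t,q) = Σ_{r=0}^{n/2−1} q^{r(2r+1)}·binom(n,2r+1)_q·D_{n−2r−1}(s,t,q)·(s−1)^r(t−1)^r + Σ_{r=1}^{n/2} q^{r(2r−1)}·binom(n,2r)_q·D_{n−2r}(s,t,q)·(s−1)^{r−1}(t−1)^r. For odd integers n ≥ 3, D_n^+(s,t,q) = Σ_{r=0}^{⌊n/2⌋} q^{r(2r+1)}·binom(n,2r+1)_q·D_{n−2r−1}(s,t,q)·(s−1)^r(t−1)^r + Σ_{r=1}^{⌊n/2⌋} q^{r(2r−1)}·binom(n,2r)_q·D_{n−2r}(s,t,q)·(s−1)^r(t−1)^{r−1}. -/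
open Finset

/-- The hyperoctahedral group `𝔅_n`, encoded as (permutation of positions, signs):
the signed permutation sends `i+1` to `±(σ i + 1)`. -/
abbrev BG (n : ℕ) := Equiv.Perm (Fin n) × (Fin n → Bool)

/-- The value `π_i` (for `1 ≤ i ≤ n`) of the signed permutation, with `π_0 = 0`. -/
def bval {n : ℕ} (w : BG n) (i : ℕ) : ℤ :=
  if h : 1 ≤ i ∧ i ≤ n then
    (if w.2 ⟨i - 1, by omega⟩ then -1 else 1) * (((w.1 ⟨i - 1, by omega⟩ : Fin n) : ℕ) + 1 : ℤ)
  else 0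

/-- `edes_B`: even `i ∈ {0,…,n−1}` with `π_i > π_{i+1}`. -/
def edesB {n : ℕ} (w : BG n) : ℕ :=
  ((range n).filter fun i => Even i ∧ bval w (i + 1) < bval w i).card

/-- `odes_B`: odd `i ∈ {0,…,n−1}` with `π_i > π_{i+1}`. -/
def odesB {n : ℕ} (w : BG n) : ℕ :=
  ((range n).filter fun i => Odd i ∧ bval w (i + 1) < bval w i).card

/-- `easc_B`: even `i ∈ {0,…,n−1}` with `π_i < π_{i+1}`. -/
def eascB {n : ℕ} (w : BG n) : ℕ :=
  ((range n).filter fun i => Even i ∧ bval w i < bval w (i + 1)).card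

/-- `oasc_B`: odd `i ∈ {0,…,n−1}` with `π_i < π_{i+1}`. -/
def oascB {n : ℕ} (w : BG n) : ℕ :=
  ((range n).filter fun i => Odd i ∧ bval w i < bval w (i + 1)).card

/-- type B inversion number -/
def invB {n : ℕ} (w : BG n) : ℕ :=
  ((Icc 1 n ×ˢ Icc 1 n).filter fun p => p.1 < p.2 ∧ bval w p.2 < bval w p.1).card
  + ((Icc 1 n ×ˢ Icc 1 n).filter fun p => p.1 < p.2 ∧ bval w p.2 < -bval w p.1).card
  + ((Icc 1 n).filter fun i => bval w i < 0).card

/-- `B_n(s,t,q)` -/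
noncomputable def Bpoly {A : Type*} [CommRing A] (n : ℕ) (s t q : A) : A :=
  ∑ w : BG n, s ^ edesB w * t ^ odesB w * q ^ invB w

/-- `B_n(1,q)` -/
noncomputable def BOne {A : Type*} [CommRing A] (n : ℕ) (q : A) : A :=
  ∑ w : BG n, q ^ invB w

/-- `[k]_q` -/
def qInt {A : Type*} [CommRing A] (k : ℕ) (q : A) : A := ∑ i ∈ range k, q ^ i

/-- `[k]_q!` -/
def qFact {A : Type*} [CommRing A] (k : ℕ) (q : A) : A := ∏ i ∈ range k, qInt (i + 1) q

/-- number of negative values `π_1,…,π_n` -/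
def negs {n : ℕ} (w : BG n) : ℕ := ((Icc 1 n).filter fun i => bval w i < 0).card

/-- the type D group `𝔇_n` inside `𝔅_n` -/
def DG (n : ℕ) : Finset (BG n) := univ.filter fun w => Even (negs w)

/-- `odes_D`: odd `i ∈ {−1,1,…,n−1}` with `π_i > π_{|i|+1}` (the index `i = −1`
contributes iff `−π_1 > π_2`). -/
def odesD {n : ℕ} (w : BG n) : ℕ :=
  ((Icc 1 (n - 1)).filter fun i => Odd i ∧ bval w (i + 1) < bval w i).card
  + (if bval w 2 < -bval w 1 then 1 else 0)

/-- `edes_D`: even `i ∈ {−1,1,…,n−1}` with `π_i > π_{i+1}`. -/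
def edesD {n : ℕ} (w : BG n) : ℕ :=
  ((Icc 1 (n - 1)).filter fun i => Even i ∧ bval w (i + 1) < bval w i).card

/-- type D inversion number -/
def invD {n : ℕ} (w : BG n) : ℕ :=
  ((Icc 1 n ×ˢ Icc 1 n).filter fun p => p.1 < p.2 ∧ bval w p.2 < bval w p.1).card
  + ((Icc 1 n ×ˢ Icc 1 n).filter fun p => p.1 < p.2 ∧ bval w p.2 < -bval w p.1).card

/-- `D_n(s,t,q)` -/
noncomputable def Dpoly {A : Type*} [CommRing A] (n : ℕ) (s t q : A) : A :=
  ∑ w ∈ DG n, s ^ edesD w * t ^ odesD w * q ^ invD w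

/-- `D_n(1,q)` -/
noncomputable def DOne {A : Type*} [CommRing A] (n : ℕ) (q : A) : A :=
  ∑ w ∈ DG n, q ^ invD w

noncomputable section

/-- the field `ℚ(q,s,t)` -/
abbrev K : Type := FractionRing (MvPolynomial (Fin 3) ℚ)

def qK : K := algebraMap (MvPolynomial (Fin 3) ℚ) K (MvPolynomial.X 0)
def sK : K := algebraMap (MvPolynomial (Fin 3) ℚ) K (MvPolynomial.X 1)
def tK : K := algebraMap (MvPolynomial (Fin 3) ℚ) K (MvPolynomial.X 2)

/-- the ring `R = ℚ(q,s,t)[M]/(M² − (1−s)(1−t))` -/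
abbrev R : Type := AdjoinRoot ((Polynomial.X : Polynomial K) ^ 2
  - Polynomial.C ((1 - sK) * (1 - tK)))

/-- the square root `M` of `(1−s)(1−t)` -/
def M : R := AdjoinRoot.root _

def ofK : K →+* R := algebraMap K R

/-- the Gaussian binomial coefficient `[n]_q!/([r]_q! [n−r]_q!)` -/
def qBinom (n r : ℕ) (q : K) : K := qFact n q / (qFact r q * qFact (n - r) q)

/-- `D_n^+(s,t,q)`, the sum over `π ∈ 𝔇_n` with `π_n > 0` -/
def DplusPoly (n : ℕ) (s t q : K) : K :=
  ∑ w ∈ ((DG n).filter fun w => 0 < bval w n),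
    s ^ edesD w * t ^ odesD w * q ^ invD w

section Peeling

variable {N : ℕ}

/-- The odd strictly increasing map on `ℤ` whose image misses `±(j+1)`. -/
def skipVal (j : ℕ) (x : ℤ) : ℤ :=
  if (j : ℤ) < x then x + 1 else if x < -(j : ℤ) then x - 1 else x

theorem skipVal_lt_skipVal (j : ℕ) (a b : ℤ) : skipVal j a < skipVal j b ↔ a < b := by
  unfold skipVal; split_ifs <;> omega

theorem neg_skipVal (j : ℕ) (a : ℤ) : -skipVal j a = skipVal j (-a) := by
  unfold skipVal; split_ifs <;> omega

theorem skipVal_neg_iff (j : ℕ) (a : ℤ) : skipVal j a < 0 ↔ a < 0 := by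
  unfold skipVal; split_ifs <;> omega

theorem lt_skipVal_iff (j : ℕ) (a : ℤ) : (j : ℤ) + 1 < skipVal j a ↔ (j : ℤ) < a := by
  unfold skipVal; split_ifs <;> omega

/-- Append the value `j+1` at the end of a signed permutation, shifting larger values. -/
def appendVal (j : Fin (N + 1)) (v : BG N) : BG (N + 1) :=
  (((finSuccEquiv' (Fin.last N)).trans (Equiv.optionCongr v.1)).trans (finSuccEquiv' j).symm,
    Fin.snoc (α := fun _ => Bool) v.2 false)

theorem appendVal_fst_castSucc (j : Fin (N + 1)) (v : BG N) (i : Fin N) :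
    (appendVal j v).1 i.castSucc = j.succAbove (v.1 i) := by
  simp [appendVal, finSuccEquiv'_last_apply_castSucc]

theorem appendVal_fst_last (j : Fin (N + 1)) (v : BG N) :
    (appendVal j v).1 (Fin.last N) = j := by
  simp [appendVal]

theorem appendVal_snd_castSucc (j : Fin (N + 1)) (v : BG N) (i : Fin N) :
    (appendVal j v).2 i.castSucc = v.2 i := by
  simp [appendVal]

theorem appendVal_snd_last (j : Fin (N + 1)) (v : BG N) :
    (appendVal j v).2 (Fin.last N) = false := by
  simp [appendVal]

theorem bval_succ {n : ℕ} (w : BG n) (i : Fin n) :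
    bval w (i + 1) = (if w.2 i then -1 else 1) * (((w.1 i : Fin n) : ℕ) + 1 : ℤ) := by
  have h : 1 ≤ (i : ℕ) + 1 ∧ (i : ℕ) + 1 ≤ n := by omega
  simp [bval, h]

theorem bval_eq_zero {n : ℕ} (w : BG n) {i : ℕ} (h : ¬(1 ≤ i ∧ i ≤ n)) : bval w i = 0 := by
  simp only [bval, dif_neg h]

theorem bval_last (w : BG (N + 1)) :
    bval w (N + 1) = (if w.2 (Fin.last N) then -1 else 1) * (((w.1 (Fin.last N) : ℕ) : ℤ) + 1) := by
  simpa using bval_succ w (Fin.last N)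

theorem bval_le {n : ℕ} (w : BG n) (i : ℕ) : bval w i ≤ n := by
  unfold bval
  split_ifs <;> omega

theorem bval_appendVal_last (j : Fin (N + 1)) (v : BG N) :
    bval (appendVal j v) (N + 1) = (j : ℤ) + 1 := by
  simp [bval_last, appendVal_fst_last, appendVal_snd_last]

theorem bval_appendVal (j : Fin (N + 1)) (v : BG N) {i : ℕ} (hi : i ≤ N) :
    bval (appendVal j v) i = skipVal j (bval v i) := by
  rcases i with _ | i
  · rw [bval_eq_zero _ (by omega), bval_eq_zero _ (by omega)]
    unfold skipVal; split_ifs <;> omega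
  · have h1 := bval_succ (appendVal j v) (Fin.castSucc ⟨i, hi⟩)
    have h2 := bval_succ v ⟨i, hi⟩
    simp only [appendVal_fst_castSucc, appendVal_snd_castSucc, Fin.val_castSucc] at h1 h2
    rw [h1, h2]
    generalize v.1 ⟨i, hi⟩ = a
    unfold skipVal
    rcases lt_or_ge a.castSucc j with h | h
    · rw [Fin.succAbove_of_castSucc_lt _ _ h]
      rw [Fin.lt_def] at h
      simp only [Fin.val_castSucc] at *
      split_ifs <;> omega
    · rw [Fin.succAbove_of_le_castSucc _ _ h]
      rw [Fin.le_def] at h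
      simp only [Fin.val_castSucc, Fin.val_succ] at *
      push_cast
      split_ifs <;> omega

theorem appendVal_injective (j : Fin (N + 1)) : Function.Injective (appendVal j) := by
  intro v v' h
  refine Prod.ext (Equiv.ext fun i => ?_) (funext fun i => ?_)
  · have := congrArg (fun w : BG (N + 1) => w.1 i.castSucc) h
    simpa [appendVal_fst_castSucc] using this
  · have := congrArg (fun w : BG (N + 1) => w.2 i.castSucc) h
    simpa [appendVal_snd_castSucc] using this

theorem exists_appendVal_eq (j : Fin (N + 1)) (w : BG (N + 1))
    (hw : bval w (N + 1) = (j : ℤ) + 1) : ∃ v, appendVal j v = w := by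
  rw [bval_last] at hw
  have hs : w.2 (Fin.last N) = false := by
    by_contra h
    simp only [Bool.not_eq_false] at h
    simp only [h, if_true] at hw
    omega
  have hl : w.1 (Fin.last N) = j := by
    simp only [hs, Bool.false_eq_true, if_false] at hw
    ext; omega
  have hex : ∀ i : Fin N, ∃ a, j.succAbove a = w.1 i.castSucc := fun i => by
    apply Fin.exists_succAbove_eq
    rw [← hl]
    exact fun h => (Fin.castSucc_lt_last i).ne (w.1.injective h)
  choose f hf using hex
  have hinj : Function.Injective f := fun a b h => by
    have : w.1 a.castSucc = w.1 b.castSucc := by rw [← hf, ← hf, h]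
    exact Fin.castSucc_injective _ (w.1.injective this)
  refine ⟨(Equiv.ofBijective f (Finite.injective_iff_bijective.1 hinj),
    fun i => w.2 i.castSucc), Prod.ext (Equiv.ext fun i => ?_) (funext fun i => ?_)⟩
  · induction i using Fin.lastCases with
    | last => rw [appendVal_fst_last, hl]
    | cast i => rw [appendVal_fst_castSucc]; exact hf i
  · induction i using Fin.lastCases with
    | last => rw [appendVal_snd_last, hs]
    | cast i => rw [appendVal_snd_castSucc]

theorem negs_appendVal (j : Fin (N + 1)) (v : BG N) : negs (appendVal j v) = negs v := by
  unfold negs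
  rw [← Finset.insert_Icc_right_eq_Icc_add_one (by omega), filter_insert, if_neg]
  · congr 1
    refine filter_congr fun i hi => ?_
    rw [bval_appendVal _ _ (mem_Icc.1 hi).2, skipVal_neg_iff]
  · rw [bval_appendVal_last]; omega

theorem invD_eq_sum {n : ℕ} (w : BG n) :
    invD w = ∑ b ∈ range n, ∑ a ∈ range b,
      ((if bval w (b + 1) < bval w (a + 1) then 1 else 0)
        + (if bval w (b + 1) < -bval w (a + 1) then 1 else 0)) := by
  have key : ∀ P : ℕ → ℕ → Prop, ∀ [∀ a b, Decidable (P a b)],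
      ((Icc 1 n ×ˢ Icc 1 n).filter fun p => p.1 < p.2 ∧ P p.1 p.2).card
        = ∑ b ∈ range n, ∑ a ∈ range b, if P (a + 1) (b + 1) then 1 else 0 := by
    intro P _
    rw [sum_sigma', ← sum_filter, ← card_eq_sum_ones]
    symm
    refine card_nbij' (fun x => (x.2 + 1, x.1 + 1)) (fun p => ⟨p.2 - 1, p.1 - 1⟩) ?_ ?_ ?_ ?_
    · rintro ⟨b, a⟩ h
      simp only [coe_filter, mem_sigma, mem_range, Set.mem_ofPred_eq, mem_product, mem_Icc] at *
      refine ⟨by omega, by omega, h.2⟩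
    · rintro ⟨a, b⟩ h
      simp only [coe_filter, mem_sigma, mem_range, Set.mem_ofPred_eq, mem_product, mem_Icc] at *
      rw [Nat.sub_add_cancel (by omega), Nat.sub_add_cancel (by omega)]
      refine ⟨by omega, h.2.2⟩
    · rintro ⟨b, a⟩ h
      simp
    · rintro ⟨a, b⟩ h
      simp only [coe_filter, Set.mem_ofPred_eq, mem_product, mem_Icc] at h
      ext <;> simp <;> omega
  unfold invD
  rw [key fun a b => bval w b < bval w a, key fun a b => bval w b < -bval w a]
  simp only [← sum_add_distrib]

theorem sum_abs_bval_gt (v : BG N) (j : ℕ) :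
    ∑ a ∈ range N, ((if (j : ℤ) < bval v (a + 1) then 1 else 0)
      + (if (j : ℤ) < -bval v (a + 1) then 1 else 0)) = N - j := by
  rw [← Fin.sum_univ_eq_sum_range
    (fun a => (if (j : ℤ) < bval v (a + 1) then 1 else 0)
      + (if (j : ℤ) < -bval v (a + 1) then 1 else 0)) N]
  have : ∀ a : Fin N, ((if (j : ℤ) < bval v (a + 1) then 1 else 0)
      + (if (j : ℤ) < -bval v (a + 1) then 1 else 0)) = if j ≤ (v.1 a : ℕ) then 1 else 0 := by
    intro a
    rw [bval_succ]
    split_ifs <;> omega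
  simp only [this]
  rw [Equiv.sum_comp v.1 (fun b : Fin N => if j ≤ (b : ℕ) then 1 else 0),
    Fin.sum_univ_eq_sum_range (fun b => if j ≤ b then 1 else 0) N, ← card_filter]
  have : (range N).filter (fun b => j ≤ b) = Ico j N := by
    ext; simp; omega
  rw [this, Nat.card_Ico]

theorem invD_appendVal (j : Fin (N + 1)) (v : BG N) :
    invD (appendVal j v) = invD v + (N - j) := by
  rw [invD_eq_sum, invD_eq_sum, sum_range_succ]
  congr 1
  · refine sum_congr rfl fun b hb => sum_congr rfl fun a ha => ?_
    rw [mem_range] at ha hb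
    rw [bval_appendVal _ _ (by omega), bval_appendVal _ _ (by omega), neg_skipVal]
    simp only [skipVal_lt_skipVal]
  · rw [← sum_abs_bval_gt v j]
    refine sum_congr rfl fun a ha => ?_
    rw [mem_range] at ha
    rw [bval_appendVal_last, bval_appendVal _ _ (by omega), neg_skipVal]
    simp only [lt_skipVal_iff]

end Peeling

section Weights

variable {A : Type*} [CommRing A] (s t q : A)

/-- The variable recording a descent at position `i ≥ 1`. -/
def desVar (i : ℕ) : A := if Even i then s else t

/-- The descent weight of the first `k` entries of a signed permutation. -/
def desWeight {n : ℕ} (k : ℕ) (w : BG n) : A :=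
  (∏ i ∈ Ico 1 k, if bval w (i + 1) < bval w i then desVar s t i else 1)
    * (if bval w 2 < -bval w 1 then t else 1)

theorem desWeight_self {n : ℕ} (w : BG n) :
    desWeight s t n w = s ^ edesD w * t ^ odesD w := by
  have hI : Icc 1 (n - 1) = Ico 1 n := by ext; simp; omega
  have hpow : ∀ (x : A) (P : ℕ → Prop) [DecidablePred P],
      x ^ ((Ico 1 n).filter P).card = ∏ i ∈ Ico 1 n, if P i then x else 1 := by
    intro x P _
    rw [← prod_filter, prod_const]
  unfold desWeight edesD odesD
  rw [hI, pow_add, hpow, hpow, ← mul_assoc, ← prod_mul_distrib]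
  congr 1
  · refine prod_congr rfl fun i _ => ?_
    by_cases he : Even i
    · simp [he, desVar]
    · simp [he, Nat.not_even_iff_odd.1 he, desVar]
  · split_ifs <;> simp

theorem desWeight_succ {n : ℕ} {k : ℕ} (hk : 1 ≤ k) (w : BG n) :
    desWeight s t (k + 1) w
      = (if bval w (k + 1) < bval w k then desVar s t k else 1) * desWeight s t k w := by
  unfold desWeight
  rw [prod_Ico_succ_top hk]
  ring

/-- Elements of `𝔇_n` whose entries after position `k` decrease and end above `j`. -/
def decTail (n k j : ℕ) : Finset (BG n) :=
  (DG n).filter fun w =>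
    (∀ i ∈ Ioo k n, bval w (i + 1) < bval w i) ∧ (k < n → (j : ℤ) < bval w n)

theorem not_bval_two_lt_of_mem_DG {n : ℕ} {w : BG n} (hw : w ∈ DG n) (hn : n ≤ 2)
    (h2 : 0 ≤ bval w 2) : ¬bval w 2 < -bval w 1 := by
  intro h
  have h1 : bval w 1 < 0 := by omega
  have hn1 : 1 ≤ n := by
    by_contra hc
    rw [bval_eq_zero w (by omega)] at h1
    omega
  have : (Icc 1 n).filter (fun i => bval w i < 0) = {1} := by
    ext i
    simp only [mem_filter, mem_Icc, mem_singleton]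
    constructor
    · rintro ⟨⟨hi, hin⟩, hneg⟩
      by_contra hne
      have : i = 2 := by omega
      subst this
      omega
    · rintro rfl
      exact ⟨⟨le_rfl, hn1⟩, h1⟩
  have hev : Even (negs w) := (mem_filter.1 hw).2
  rw [negs, this] at hev
  simp at hev

theorem appendVal_mem_DG {N : ℕ} (j : Fin (N + 1)) (v : BG N) :
    appendVal j v ∈ DG (N + 1) ↔ v ∈ DG N := by
  simp [DG, negs_appendVal]

theorem desWeight_appendVal {N k : ℕ} (hk : k ≤ N) (j : Fin (N + 1)) {v : BG N} (hv : v ∈ DG N) :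
    desWeight s t k (appendVal j v) = desWeight s t k v := by
  unfold desWeight
  congr 1
  · refine prod_congr rfl fun i hi => ?_
    rw [mem_Ico] at hi
    rw [bval_appendVal _ _ (by omega), bval_appendVal _ _ (by omega)]
    simp only [skipVal_lt_skipVal]
  · rcases le_or_gt 2 N with hN | hN
    · rw [bval_appendVal _ _ hN, bval_appendVal _ _ (by omega), neg_skipVal]
      simp only [skipVal_lt_skipVal]
    · rw [if_neg, if_neg]
      · refine not_bval_two_lt_of_mem_DG hv (by omega) ?_
        rw [bval_eq_zero _ (by omega)]
      · refine not_bval_two_lt_of_mem_DG ((appendVal_mem_DG j v).2 hv) (by omega) ?_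
        rcases Nat.lt_or_ge N 1 with h | h
        · rw [bval_eq_zero _ (by omega)]
        · obtain rfl : N = 1 := by omega
          rw [bval_appendVal_last j v]
          omega

theorem appendVal_mem_decTail {N k : ℕ} (hk : k ≤ N) (j : Fin (N + 1)) (v : BG N) :
    appendVal j v ∈ decTail (N + 1) k j ↔ v ∈ decTail N k j := by
  simp only [decTail, mem_filter, appendVal_mem_DG, bval_appendVal_last]
  refine and_congr_right fun _ => ?_
  constructor
  · rintro ⟨h, -⟩
    refine ⟨fun i hi => ?_, fun hkN => ?_⟩
    · rw [mem_Ioo] at hi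
      have := h i (mem_Ioo.2 (by omega))
      rwa [bval_appendVal _ _ (by omega), bval_appendVal _ _ (by omega),
        skipVal_lt_skipVal] at this
    · have := h N (mem_Ioo.2 (by omega))
      rwa [bval_appendVal_last, bval_appendVal _ _ le_rfl, lt_skipVal_iff] at this
  · rintro ⟨h, h'⟩
    refine ⟨fun i hi => ?_, fun _ => by omega⟩
    rw [mem_Ioo] at hi
    rcases Nat.lt_or_ge i N with hiN | hiN
    · rw [bval_appendVal _ _ (by omega), bval_appendVal _ _ (by omega), skipVal_lt_skipVal]
      exact h i (mem_Ioo.2 (by omega))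
    · obtain rfl : i = N := by omega
      rw [bval_appendVal_last, bval_appendVal _ _ le_rfl, lt_skipVal_iff]
      exact h' (by omega)

/-- Weighted count of `decTail`, ignoring descents after position `k`. -/
def decTailSum (n k j : ℕ) : A :=
  ∑ w ∈ decTail n k j, desWeight s t k w * q ^ invD w

theorem decTailSum_self (n j : ℕ) : decTailSum s t q n n j = Dpoly n s t q := by
  unfold decTailSum Dpoly
  have : decTail n n j = DG n := by simp [decTail]
  rw [this]
  exact sum_congr rfl fun w _ => by rw [desWeight_self]

theorem decTailSum_top {n k : ℕ} (hk : k < n) : decTailSum s t q n k n = 0 := by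
  unfold decTailSum
  refine sum_eq_zero fun w hw => ?_
  have := (mem_filter.1 hw).2.2 hk
  have := bval_le w n
  omega

theorem decTailSum_succ {N k j : ℕ} (hk : k ≤ N) (hj : j ≤ N) :
    decTailSum s t q (N + 1) k j
      = decTailSum s t q (N + 1) k (j + 1) + q ^ (N - j) * decTailSum s t q N k j := by
  unfold decTailSum
  rw [← sum_filter_add_sum_filter_not (decTail (N + 1) k j)
    (fun w => (j : ℤ) + 1 < bval w (N + 1))]
  congr 1
  · refine sum_congr ?_ fun _ _ => rfl
    ext w
    simp only [decTail, mem_filter]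
    push_cast
    constructor
    · rintro ⟨⟨h1, h2, -⟩, h3⟩
      exact ⟨h1, h2, fun _ => h3⟩
    · rintro ⟨h1, h2, h3⟩
      have := h3 (by omega)
      exact ⟨⟨h1, h2, fun _ => by omega⟩, this⟩
  · rw [mul_sum]
    let J : Fin (N + 1) := ⟨j, by omega⟩
    symm
    refine sum_nbij (appendVal J) ?_ (appendVal_injective J).injOn ?_ ?_
    · intro v hv
      refine mem_filter.2 ⟨(appendVal_mem_decTail hk J v).2 hv, ?_⟩
      rw [bval_appendVal_last]
      simp [J]
    · intro w hw
      rw [mem_coe, mem_filter] at hw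
      have h1 := (mem_filter.1 hw.1).2.2 (by omega)
      obtain ⟨v, rfl⟩ := exists_appendVal_eq J w (by simp only [J]; omega)
      exact ⟨v, (appendVal_mem_decTail hk J v).1 hw.1, rfl⟩
    · intro v hv
      rw [desWeight_appendVal s t hk J (mem_filter.1 hv).1, invD_appendVal, pow_add]
      ring

/-- The elementary symmetric polynomial of degree `m` in `1, q, …, q^{N-1}`. -/
def qEsymm : ℕ → ℕ → A
  | _, 0 => 1
  | 0, _ + 1 => 0
  | N + 1, m + 1 => qEsymm N (m + 1) + q ^ N * qEsymm N m

theorem decTailSum_eq (k m : ℕ) : ∀ d j : ℕ, j + d = k + m →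
    decTailSum s t q (k + m) k j = qEsymm q d m * Dpoly k s t q := by
  induction m with
  | zero =>
    intro d j _
    rw [add_zero, decTailSum_self]
    simp [qEsymm]
  | succ m ihm =>
    intro d
    induction d with
    | zero =>
      intro j hj
      obtain rfl : j = k + (m + 1) := by omega
      rw [decTailSum_top _ _ _ (by omega)]
      simp [qEsymm]
    | succ d ihd =>
      intro j hj
      rw [← add_assoc, decTailSum_succ s t q (by omega) (by omega), add_assoc k m 1,
        ihd (j + 1) (by omega), ihm d j (by omega), qEsymm]
      obtain rfl : d = k + m - j := by omega
      ring

theorem qEsymm_eq_zero : ∀ {N m : ℕ}, N < m → qEsymm q N m = 0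
  | _, 0, h => by omega
  | 0, _ + 1, _ => rfl
  | N + 1, m + 1, h => by
    rw [qEsymm, qEsymm_eq_zero (by omega), qEsymm_eq_zero (by omega)]
    simp

theorem qInt_add (a b : ℕ) : qInt (a + b) q = qInt a q + q ^ a * qInt b q := by
  simp [qInt, sum_range_add, pow_add, mul_sum]

theorem qFact_succ (k : ℕ) : qFact (k + 1) q = qFact k q * qInt (k + 1) q :=
  prod_range_succ _ _

theorem qEsymm_mul_qFact (N : ℕ) : ∀ m ≤ N,
    qEsymm q N m * (qFact m q * qFact (N - m) q) = q ^ (m.choose 2) * qFact N q := by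
  induction N with
  | zero =>
    intro m hm
    obtain rfl : m = 0 := by omega
    simp [qEsymm, qFact]
  | succ N ih =>
    rintro (_ | m) hm
    · simp [qEsymm, qFact]
    · have hc : (m + 1).choose 2 = m.choose 2 + m := by
        rw [Nat.choose_succ_succ' m 1, Nat.choose_one_right, add_comm]
      have h0 := ih m (by omega)
      rw [qEsymm, hc, qFact_succ, qFact_succ, Nat.add_sub_add_right]
      rcases Nat.lt_or_ge m N with h | h
      · obtain ⟨c, rfl⟩ : ∃ c, N = m + 1 + c := ⟨N - (m + 1), by omega⟩
        have h1 := ih (m + 1) (by omega)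
        have e1 : m + 1 + c - m = c + 1 := by omega
        have e2 : m + 1 + c - (m + 1) = c := by omega
        rw [e1, qFact_succ] at h0 ⊢
        rw [e2, qFact_succ, hc] at h1
        have h2 := qInt_add q (c + 1) (m + 1)
        have e3 : c + 1 + (m + 1) = m + 1 + c + 1 := by omega
        rw [e3] at h2
        rw [h2]
        linear_combination qInt (c + 1) q * h1 + q ^ (m + 1 + c) * qInt (m + 1) q * h0
      · obtain rfl : m = N := by omega
        rw [qEsymm_eq_zero q (by omega)]
        linear_combination q ^ m * qInt (m + 1) q * h0

theorem sum_decTail_eq {n : ℕ} (k : ℕ) (hk : k < n) :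
    (∑ w ∈ decTail n k 0, desWeight s t (k + 1) w * q ^ invD w)
        * ∏ i ∈ Ico (k + 1) n, (desVar s t i - 1)
      = ∑ i ∈ range (k + 1), decTailSum s t q n i 0 * ∏ l ∈ Ico (i + 1) n, (desVar s t l - 1) := by
  induction k with
  | zero => simp [decTailSum, desWeight]
  | succ k ih =>
    rw [sum_range_succ, ← ih (by omega), prod_eq_prod_Ico_succ_bot (by omega : k + 1 < n),
      ← mul_assoc, ← add_mul, decTailSum]
    congr 1
    have hT : decTail n k 0
        = (decTail n (k + 1) 0).filter fun w => bval w (k + 1 + 1) < bval w (k + 1) := by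
      ext w
      simp only [decTail, mem_filter, mem_Ioo]
      constructor
      · rintro ⟨h1, h2, h3⟩
        exact ⟨⟨h1, fun i hi => h2 i (by omega), fun _ => h3 (by omega)⟩, h2 _ (by omega)⟩
      · rintro ⟨⟨h1, h2, h3⟩, h4⟩
        refine ⟨h1, fun i hi => ?_, fun _ => h3 (by omega)⟩
        rcases eq_or_ne i (k + 1) with rfl | hne
        · exact h4
        · exact h2 i (by omega)
    rw [hT, sum_filter, sum_mul, ← sum_add_distrib]
    refine sum_congr rfl fun w _ => ?_
    rw [desWeight_succ s t (by omega : 1 ≤ k + 1)]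
    split_ifs <;> ring

theorem sum_DG_pos_eq {n : ℕ} (hn : 1 ≤ n) :
    ∑ w ∈ (DG n).filter (fun w => 0 < bval w n), s ^ edesD w * t ^ odesD w * q ^ invD w
      = ∑ m ∈ range n, qEsymm q n (m + 1) * Dpoly (n - (m + 1)) s t q
          * ∏ l ∈ Ico (n - m) n, (desVar s t l - 1) := by
  obtain ⟨k, rfl⟩ : ∃ k, n = k + 1 := ⟨n - 1, by omega⟩
  have h := sum_decTail_eq s t q (n := k + 1) k (by omega)
  rw [Ico_self, prod_empty, mul_one] at h
  have hT : (DG (k + 1)).filter (fun w => 0 < bval w (k + 1)) = decTail (k + 1) k 0 := by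
    ext w
    simp only [decTail, mem_filter, mem_Ioo]
    refine and_congr_right fun _ => ⟨fun h => ⟨fun i hi => by omega, fun _ => h⟩, fun h => ?_⟩
    simpa using h.2
  rw [hT]
  simp only [desWeight_self] at h
  rw [h, ← sum_range_reflect]
  refine sum_congr rfl fun m hm => ?_
  rw [mem_range] at hm
  obtain ⟨i, hi⟩ : ∃ i, k + 1 = i + (m + 1) := ⟨k - m, by omega⟩
  have e1 : k + 1 - 1 - m = i := by omega
  have e2 : k + 1 - (m + 1) = i := by omega
  have e3 : k + 1 - m = i + 1 := by omega
  rw [e1, e2, e3, hi, decTailSum_eq s t q i (m + 1) (i + (m + 1)) 0 (by omega)]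

theorem prod_desVar_even (a r : ℕ) :
    ∏ l ∈ Ico a (a + 2 * r), (desVar s t l - 1) = (s - 1) ^ r * (t - 1) ^ r := by
  induction r with
  | zero => simp
  | succ r ih =>
    rw [mul_add, mul_one, ← add_assoc, prod_Ico_succ_top (by omega), prod_Ico_succ_top (by omega),
      ih]
    by_cases h : Even a
    · have h2 : Even (a + 2 * r) := h.add (even_two_mul r)
      have h3 : ¬Even (a + 2 * r + 1) := by simpa [Nat.even_add_one] using h2
      simp only [desVar, h2, h3, if_true, if_false]
      ring
    · have h2 : ¬Even (a + 2 * r) := by simpa [Nat.even_add] using h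
      have h3 : Even (a + 2 * r + 1) := by simpa [Nat.even_add_one] using h2
      simp only [desVar, h2, h3, if_true, if_false]
      ring

theorem prod_desVar_odd (a r : ℕ) :
    ∏ l ∈ Ico a (a + 2 * r + 1), (desVar s t l - 1)
      = (s - 1) ^ r * (t - 1) ^ r * (desVar s t a - 1) := by
  rw [prod_Ico_succ_top (by omega), prod_desVar_even]
  congr 2
  simp [desVar, Nat.even_add]

end Weights

theorem sum_range_two_mul_eq {A : Type*} [AddCommMonoid A] (f : ℕ → A) (p : ℕ) :
    ∑ m ∈ range (2 * p), f m = ∑ r ∈ range p, f (2 * r) + ∑ r ∈ Icc 1 p, f (2 * r - 1) := by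
  induction p with
  | zero => simp
  | succ p ih =>
    rw [mul_add, mul_one, sum_range_succ, sum_range_succ, ih, sum_range_succ,
      sum_Icc_succ_top (by omega)]
    have : 2 * (p + 1) - 1 = 2 * p + 1 := by omega
    rw [this]
    abel

theorem qInt_qK_ne_zero (k : ℕ) : qInt (k + 1) qK ≠ 0 := by
  have h : qInt (k + 1) qK
      = algebraMap (MvPolynomial (Fin 3) ℚ) K (∑ i ∈ range (k + 1), MvPolynomial.X 0 ^ i) := by
    simp [qInt, qK]
  rw [h, Ne, FaithfulSMul.algebraMap_eq_zero_iff]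
  intro h0
  have h1 := congrArg (MvPolynomial.eval (fun _ => (1 : ℚ))) h0
  simp only [map_sum, map_pow, MvPolynomial.eval_X, one_pow, sum_const, card_range, map_zero,
    nsmul_eq_mul, mul_one] at h1
  exact Nat.cast_ne_zero.2 k.succ_ne_zero h1

theorem qFact_qK_ne_zero (k : ℕ) : qFact k qK ≠ 0 :=
  prod_ne_zero_iff.2 fun i _ => qInt_qK_ne_zero i

theorem qEsymm_qK_eq {N m : ℕ} (h : m ≤ N) :
    qEsymm qK N m = qK ^ (m.choose 2) * qBinom N m qK := by
  rw [qBinom, ← mul_div_assoc, eq_div_iff (mul_ne_zero (qFact_qK_ne_zero _) (qFact_qK_ne_zero _)),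
    qEsymm_mul_qFact _ _ _ h]

theorem choose_two_odd (r : ℕ) : (2 * r + 1).choose 2 = r * (2 * r + 1) := by
  rw [Nat.choose_two_right, Nat.add_sub_cancel]
  exact Nat.div_eq_of_eq_mul_left (by norm_num) (by ring)

theorem choose_two_even (r : ℕ) : (2 * r).choose 2 = r * (2 * r - 1) := by
  rw [Nat.choose_two_right]
  exact Nat.div_eq_of_eq_mul_left (by norm_num) (by ring)

/-- The contribution of an odd-length decreasing tail. -/
theorem tail_term_odd {n r : ℕ} (h : 2 * r + 1 ≤ n) :
    qEsymm qK n (2 * r + 1) * Dpoly (n - (2 * r + 1)) sK tK qK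
        * ∏ l ∈ Ico (n - 2 * r) n, (desVar sK tK l - 1)
      = qK ^ (r * (2 * r + 1)) * qBinom n (2 * r + 1) qK
          * Dpoly (n - 2 * r - 1) sK tK qK * (sK - 1) ^ r * (tK - 1) ^ r := by
  have hp := prod_desVar_even sK tK (n - 2 * r) r
  rw [Nat.sub_add_cancel (by omega)] at hp
  rw [hp, qEsymm_qK_eq h, choose_two_odd, Nat.sub_sub]
  ring

/-- The contribution of an even-length decreasing tail. -/
theorem tail_term_even {n r : ℕ} (hr : 1 ≤ r) (h : 2 * r ≤ n) :
    qEsymm qK n (2 * r - 1 + 1) * Dpoly (n - (2 * r - 1 + 1)) sK tK qK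
        * ∏ l ∈ Ico (n - (2 * r - 1)) n, (desVar sK tK l - 1)
      = qK ^ (r * (2 * r - 1)) * qBinom n (2 * r) qK * Dpoly (n - 2 * r) sK tK qK
          * ((sK - 1) ^ (r - 1) * (tK - 1) ^ (r - 1) * (desVar sK tK (n + 1) - 1)) := by
  have hp := prod_desVar_odd sK tK (n - (2 * r - 1)) (r - 1)
  have e : n - (2 * r - 1) + 2 * (r - 1) + 1 = n := by omega
  have e' : desVar sK tK (n - (2 * r - 1)) = desVar sK tK (n + 1) := by
    have : n + 1 = n - (2 * r - 1) + 2 * r := by omega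
    rw [this]
    simp [desVar, Nat.even_add]
  rw [e, e'] at hp
  rw [hp, Nat.sub_add_cancel (by omega), qEsymm_qK_eq h, choose_two_even]

theorem q_hyatt_recurrence_typeD :
    (∀ n : ℕ, 2 ≤ n → Even n →
      DplusPoly n sK tK qK =
        (∑ r ∈ range (n / 2), qK ^ (r * (2 * r + 1)) * qBinom n (2 * r + 1) qK
          * Dpoly (n - 2 * r - 1) sK tK qK * (sK - 1) ^ r * (tK - 1) ^ r)
        + ∑ r ∈ Icc 1 (n / 2), qK ^ (r * (2 * r - 1)) * qBinom n (2 * r) qK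
          * Dpoly (n - 2 * r) sK tK qK * (sK - 1) ^ (r - 1) * (tK - 1) ^ r)
    ∧
    (∀ n : ℕ, 3 ≤ n → Odd n →
      DplusPoly n sK tK qK =
        (∑ r ∈ range (n / 2 + 1), qK ^ (r * (2 * r + 1)) * qBinom n (2 * r + 1) qK
          * Dpoly (n - 2 * r - 1) sK tK qK * (sK - 1) ^ r * (tK - 1) ^ r)
        + ∑ r ∈ Icc 1 (n / 2), qK ^ (r * (2 * r - 1)) * qBinom n (2 * r) qK
          * Dpoly (n - 2 * r) sK tK qK * (sK - 1) ^ r * (tK - 1) ^ (r - 1)) := by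
  refine ⟨fun n hn hev => ?_, fun n hn hodd => ?_⟩
  · obtain ⟨p, hp⟩ := hev.two_dvd
    rw [DplusPoly, sum_DG_pos_eq sK tK qK (by omega)]
    have hp2 : n / 2 = p := by omega
    rw [hp2]
    conv_lhs => rw [show range n = range (2 * p) by rw [hp]]
    rw [sum_range_two_mul_eq]
    congr 1
    · refine sum_congr rfl fun r hr => ?_
      rw [mem_range] at hr
      exact tail_term_odd (by omega)
    · refine sum_congr rfl fun r hr => ?_
      rw [mem_Icc] at hr
      rw [tail_term_even hr.1 (by omega), desVar, if_neg (by simpa [Nat.even_add_one] using hev)]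
      obtain ⟨c, rfl⟩ : ∃ c, r = c + 1 := ⟨r - 1, by omega⟩
      rw [Nat.add_sub_cancel, pow_succ (tK - 1)]
      ring
  · obtain ⟨p, hp⟩ := hodd
    rw [DplusPoly, sum_DG_pos_eq sK tK qK (by omega)]
    have hp2 : n / 2 = p := by omega
    rw [hp2]
    conv_lhs => rw [show range n = range (2 * p + 1) by rw [hp]]
    rw [sum_range_succ, sum_range_two_mul_eq, add_right_comm, ← sum_range_succ (fun r =>
      qEsymm qK n (2 * r + 1) * Dpoly (n - (2 * r + 1)) sK tK qK
        * ∏ l ∈ Ico (n - 2 * r) n, (desVar sK tK l - 1))]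
    congr 1
    · refine sum_congr rfl fun r hr => ?_
      rw [mem_range] at hr
      exact tail_term_odd (by omega)
    · refine sum_congr rfl fun r hr => ?_
      rw [mem_Icc] at hr
      have hev : Even (n + 1) := ⟨p + 1, by omega⟩
      rw [tail_term_even hr.1 (by omega), desVar, if_pos hev]
      obtain ⟨c, rfl⟩ : ∃ c, r = c + 1 := ⟨r - 1, by omega⟩
      rw [Nat.add_sub_cancel, pow_succ (sK - 1)]
      ring

end
end

section
/- For 0 ≤ i ≤ n−1 let G_{n,i} = {π ∈ 𝔅_n : π_{i+1} < π_{i+2} < ⋯ < π_n}, and let G_{n,−1} = {identity}. Write W(S) = Σ_{π∈S} s^{edes_B(π)} t^{odes_B(π)} q^{inv_B(π)}. If 0 ≤ i ≤ n−1 is odd then B_i(1,q)·[n−i]_q!·W(G_{n,i}) = t·B_i(s,t,q)·B_n(1,q) + (1−t)·B_i(1,q)·[n−i]_q!·W(G_{n,i−1}), and if 0 ≤ i ≤ n−1 is even then B_i(1,q)·[n−i]_q!·W(G_{n,i}) = s·B_i(s,t,q)·B_n(1,q) + (1−s)·B_i(1,q)·[n−i]_q!·W(G_{n,i−1}) (these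 are identities of polynomials in s, t, q). -/
open Finset

noncomputable section

/-- `G_{n,i}` (for `i ≥ 0`): signed permutations whose last `n − i` entries increase;
for `i = −1` this is the single increasing signed permutation `0 < π_1 < ⋯ < π_n`,
i.e. the identity. -/
def Gset (n : ℕ) (i : ℤ) : Finset (BG n) :=
  univ.filter fun w => ∀ j : ℕ, j < n → i + 1 ≤ (j : ℤ) → bval w j < bval w (j + 1)

/-- `W(S) = Σ_{π∈S} s^{edes_B} t^{odes_B} q^{inv_B}` -/
def W {n : ℕ} (S : Finset (BG n)) : K :=
  ∑ w ∈ S, sK ^ edesB w * tK ^ odesB w * qK ^ invB w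

section SignedWords

/-- The sign attached to a Boolean: `true` is `-1`. -/
def boolSign (b : Bool) : ℤ := if b then -1 else 1

lemma boolSign_xor (a b : Bool) : boolSign (xor a b) = boolSign a * boolSign b := by
  cases a <;> cases b <;> simp [boolSign]

/-- The right action of a signed permutation on words of integers. -/
def signedAct {n : ℕ} (a : Fin n → ℤ) (u : BG n) : Fin n → ℤ :=
  fun j => boolSign (u.2 j) * a (u.1 j)

/-- The one-line word of a signed permutation. -/
def signedWord {n : ℕ} (w : BG n) : Fin n → ℤ := signedAct (fun j => (j : ℤ) + 1) w

/-- The product of signed permutations. -/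
def signedMul {n : ℕ} (u v : BG n) : BG n :=
  (u.1 * v.1, fun j => xor (u.2 (v.1 j)) (v.2 j))

lemma signedAct_mul {n : ℕ} (a : Fin n → ℤ) (u v : BG n) :
    signedAct a (signedMul u v) = signedAct (signedAct a u) v := by
  funext j
  simp only [signedAct, signedMul, boolSign_xor, Equiv.Perm.mul_apply]
  ring

lemma signedMul_right_bijective {n : ℕ} (u : BG n) : Function.Bijective (signedMul u) := by
  rw [← Finite.injective_iff_bijective]
  rintro ⟨v, x⟩ ⟨w, y⟩ h
  simp only [signedMul, Prod.mk.injEq, mul_right_inj] at h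
  obtain ⟨rfl, h⟩ := h
  refine Prod.ext rfl (funext fun j => ?_)
  simpa using congrFun h j

lemma signedMul_left_bijective {n : ℕ} (v : BG n) :
    Function.Bijective fun u : BG n => signedMul u v := by
  rw [← Finite.injective_iff_bijective]
  rintro ⟨u, x⟩ ⟨w, y⟩ h
  simp only [signedMul, Prod.mk.injEq, mul_left_inj] at h
  obtain ⟨rfl, h⟩ := h
  refine Prod.ext rfl (funext fun j => ?_)
  simpa using congrFun h (v.1.symm j)

/-- The extension of a word to all of `ℕ`, with letters in positions `1, …, n`. -/
def wordExt {n : ℕ} (x : Fin n → ℤ) (k : ℕ) : ℤ :=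
  if h : 1 ≤ k ∧ k ≤ n then x ⟨k - 1, by omega⟩ else 0

lemma bval_eq_wordExt {n : ℕ} (w : BG n) : bval w = wordExt (signedWord w) := rfl

lemma wordExt_succ {n : ℕ} (x : Fin n → ℤ) (j : Fin n) : wordExt x (j + 1) = x j := by
  have : 1 ≤ (j : ℕ) + 1 ∧ (j : ℕ) + 1 ≤ n := by omega
  simp [wordExt]

lemma wordExt_comp_castAdd {i m : ℕ} (x : Fin (i + m) → ℤ) {k : ℕ} (hk : k ≤ i) :
    wordExt (x ∘ Fin.castAdd m) k = wordExt x k := by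
  unfold wordExt
  by_cases h : 1 ≤ k
  · rw [dif_pos ⟨h, hk⟩, dif_pos ⟨h, by omega⟩]; rfl
  · rw [dif_neg (by omega), dif_neg (by omega)]

/-- A word whose letters are nonzero with distinct absolute values. -/
def IsSignedWord {n : ℕ} (a : Fin n → ℤ) : Prop :=
  (∀ j, a j ≠ 0) ∧ Function.Injective fun j => |a j|

lemma IsSignedWord.injective {n : ℕ} {a : Fin n → ℤ} (h : IsSignedWord a) :
    Function.Injective a := fun j k hjk => h.2 (by simp [hjk])

lemma IsSignedWord.comp {n m : ℕ} {a : Fin n → ℤ} (h : IsSignedWord a) {f : Fin m → Fin n}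
    (hf : Function.Injective f) : IsSignedWord (a ∘ f) :=
  ⟨fun _ => h.1 _, h.2.comp hf⟩

lemma isSignedWord_signedWord {n : ℕ} (w : BG n) : IsSignedWord (signedWord w) := by
  have habs : ∀ j, |signedWord w j| = (w.1 j : ℤ) + 1 := by
    intro j
    simp only [signedWord, signedAct, boolSign, abs_mul]
    have : |((w.1 j : ℕ) : ℤ) + 1| = ((w.1 j : ℕ) : ℤ) + 1 := abs_of_nonneg (by omega)
    rw [this]
    split_ifs <;> simp
  refine ⟨fun j h0 => ?_, fun j k hjk => ?_⟩
  · have := habs j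
    rw [h0, abs_zero] at this
    omega
  · simp only [habs] at hjk
    exact w.1.injective (Fin.ext (by omega))

/-- Two words with the same comparisons among the letters, their negatives and `0`. -/
def SameSignedPattern {n : ℕ} (x y : Fin n → ℤ) : Prop :=
  (∀ j k, x j < x k ↔ y j < y k) ∧ (∀ j k, x j < -x k ↔ y j < -y k) ∧
    (∀ j, x j < 0 ↔ y j < 0) ∧ ∀ j, 0 < x j ↔ 0 < y j

lemma sameSignedPattern_signedAct {n : ℕ} {c d : Fin n → ℤ} (hc : StrictMono c)
    (hc0 : ∀ j, 0 < c j) (hd : StrictMono d) (hd0 : ∀ j, 0 < d j) (u : BG n) :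
    SameSignedPattern (signedAct c u) (signedAct d u) := by
  have key : ∀ j k, c j < c k ↔ d j < d k := fun j k => by
    rw [hc.lt_iff_lt, hd.lt_iff_lt]
  refine ⟨fun j k => ?_, fun j k => ?_, fun j => ?_, fun j => ?_⟩
  · have h1 := key (u.1 j) (u.1 k)
    have h2 := key (u.1 k) (u.1 j)
    have := hc0 (u.1 j)
    have := hc0 (u.1 k)
    have := hd0 (u.1 j)
    have := hd0 (u.1 k)
    simp only [signedAct, boolSign]
    split_ifs <;> omega
  · have h1 := key (u.1 j) (u.1 k)
    have h2 := key (u.1 k) (u.1 j)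
    have := hc0 (u.1 j)
    have := hc0 (u.1 k)
    have := hd0 (u.1 j)
    have := hd0 (u.1 k)
    simp only [signedAct, boolSign]
    split_ifs <;> omega
  · have := hc0 (u.1 j)
    have := hd0 (u.1 j)
    simp only [signedAct, boolSign]
    split_ifs <;> omega
  · have := hc0 (u.1 j)
    have := hd0 (u.1 j)
    simp only [signedAct, boolSign]
    split_ifs <;> omega

lemma exists_strictMono_comp {n : ℕ} {b : Fin n → ℤ} (hb : Function.Injective b) :
    ∃ v : Equiv.Perm (Fin n), StrictMono (b ∘ v) :=
  ⟨Tuple.sort b, (Tuple.monotone_sort b).strictMono_of_injective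
    (hb.comp (Tuple.sort b).injective)⟩

lemma IsSignedWord.exists_signedAct_strictMono {n : ℕ} {a : Fin n → ℤ} (h : IsSignedWord a) :
    ∃ u : BG n, StrictMono (signedAct a u) ∧ ∀ j, 0 < signedAct a u j := by
  obtain ⟨v, hv⟩ := exists_strictMono_comp h.2
  have key : signedAct a (v, fun j => decide (a (v j) < 0)) = (fun j => |a j|) ∘ v := by
    funext j
    simp only [signedAct, boolSign, decide_eq_true_eq, Function.comp]
    split_ifs with h0
    · rw [abs_of_neg h0]; ring
    · rw [abs_of_nonneg (not_lt.mp h0)]; ring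
  refine ⟨(v, fun j => decide (a (v j) < 0)), ?_, fun j => ?_⟩
  · rw [key]; exact hv
  · rw [key]; exact abs_pos.mpr (h.1 _)

/-- Summing a pattern statistic over an orbit of words gives its sum over `𝔅_n`. -/
lemma sum_signedAct {A : Type*} [AddCommMonoid A] {n : ℕ} (F : (Fin n → ℤ) → A)
    (hF : ∀ x y, SameSignedPattern x y → F x = F y) {a : Fin n → ℤ} (ha : IsSignedWord a) :
    ∑ u : BG n, F (signedAct a u) = ∑ u : BG n, F (signedWord u) := by
  obtain ⟨u₀, hm, hp⟩ := ha.exists_signedAct_strictMono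
  rw [← (signedMul_right_bijective u₀).sum_comp fun u => F (signedAct a u)]
  refine Finset.sum_congr rfl fun u _ => ?_
  rw [signedAct_mul]
  refine hF _ _ (sameSignedPattern_signedAct hm hp ?_ ?_ u)
  · intro j k hjk
    have : (j : ℕ) < k := hjk
    change (j : ℤ) + 1 < (k : ℤ) + 1
    omega
  · intro j
    positivity

/-- Summing an order-pattern statistic over the rearrangements of an injective word. -/
lemma sum_perm_comp {A : Type*} [AddCommMonoid A] {n : ℕ} (F : (Fin n → ℤ) → A)
    (hF : ∀ x y : Fin n → ℤ, (∀ j k, x j < x k ↔ y j < y k) → F x = F y)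
    {b : Fin n → ℤ} (hb : Function.Injective b) :
    ∑ v : Equiv.Perm (Fin n), F (b ∘ v) =
      ∑ v : Equiv.Perm (Fin n), F (fun j => ((v j : ℕ) : ℤ)) := by
  obtain ⟨v₀, hm⟩ := exists_strictMono_comp hb
  rw [← Equiv.sum_comp (Equiv.mulLeft v₀) <| fun v : Equiv.Perm (Fin n) => F (b ∘ v)]
  refine Finset.sum_congr rfl fun v _ => hF _ _ fun j k => ?_
  have := hm.lt_iff_lt (a := v j) (b := v k)
  simp only [Function.comp, Equiv.coe_mulLeft, Equiv.Perm.mul_apply] at this ⊢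
  rw [this]
  simp

/-- The number of inversions of a word. -/
def wordInv {n : ℕ} (x : Fin n → ℤ) : ℕ :=
  ∑ j, ∑ k, if j < k ∧ x k < x j then 1 else 0

/-- The number of pairs of positions whose letters have negative sum. -/
def wordNegPairs {n : ℕ} (x : Fin n → ℤ) : ℕ :=
  ∑ j, ∑ k, if j < k ∧ x k < -x j then 1 else 0

/-- The number of negative letters of a word. -/
def wordNeg {n : ℕ} (x : Fin n → ℤ) : ℕ := ∑ j, if x j < 0 then 1 else 0

lemma sum_Icc_one_eq_sum_fin {A : Type*} [AddCommMonoid A] (n : ℕ) (f : ℕ → A) :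
    ∑ j ∈ Icc 1 n, f j = ∑ j : Fin n, f (j + 1) := by
  induction n with
  | zero => simp
  | succ n ih => rw [Finset.sum_Icc_succ_top (by omega), ih, Fin.sum_univ_castSucc]; simp

lemma card_filter_Icc_one (n : ℕ) (p : ℕ → Prop) [DecidablePred p] :
    ((Icc 1 n).filter p).card = ∑ j : Fin n, if p (j + 1) then 1 else 0 := by
  rw [Finset.card_filter, sum_Icc_one_eq_sum_fin]

lemma card_filter_Icc_prod (n : ℕ) (p : ℕ × ℕ → Prop) [DecidablePred p] :
    ((Icc 1 n ×ˢ Icc 1 n).filter p).card =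
      ∑ j : Fin n, ∑ k : Fin n, if p (j + 1, k + 1) then 1 else 0 := by
  rw [Finset.card_filter, Finset.sum_product, sum_Icc_one_eq_sum_fin]
  simp only [sum_Icc_one_eq_sum_fin]

/-- The type B length of a word. -/
def wordLength {n : ℕ} (x : Fin n → ℤ) : ℕ := wordInv x + wordNegPairs x + wordNeg x

lemma invB_eq_wordLength {n : ℕ} (w : BG n) : invB w = wordLength (signedWord w) := by
  rw [invB, card_filter_Icc_prod, card_filter_Icc_prod, card_filter_Icc_one]
  simp only [bval_eq_wordExt, wordExt_succ, add_lt_add_iff_right, Fin.val_fin_lt]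
  rfl

lemma wordInv_congr {n : ℕ} {x y : Fin n → ℤ} (h : ∀ j k, x j < x k ↔ y j < y k) :
    wordInv x = wordInv y := by
  simp only [wordInv, h]

lemma wordLength_congr {n : ℕ} {x y : Fin n → ℤ} (h : SameSignedPattern x y) :
    wordLength x = wordLength y := by
  obtain ⟨h1, h2, h3, -⟩ := h
  simp only [wordLength, wordInv, wordNegPairs, wordNeg, h1, h2, h3]

/-- The part of the type B length of a concatenation that does not come from the length of the
first block or the inversions of the second one. -/
def crossLength {i m : ℕ} (x : Fin i → ℤ) (y : Fin m → ℤ) : ℕ :=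
  ∑ k, ∑ j, ((if y k < x j then 1 else 0) + if y k < -x j then 1 else 0)
    + wordNegPairs y + wordNeg y

lemma wordLength_eq_add_crossLength {i m : ℕ} (a : Fin (i + m) → ℤ) :
    wordLength a = wordLength (a ∘ Fin.castAdd m) + wordInv (a ∘ Fin.natAdd i) +
      crossLength (a ∘ Fin.castAdd m) (a ∘ Fin.natAdd i) := by
  have h1 : ∀ (j : Fin i) (k : Fin m), Fin.castAdd m j < Fin.natAdd i k := fun j k => by
    rw [Fin.lt_def]; simp; omega
  have h2 : ∀ (j : Fin m) (k : Fin i), ¬ Fin.natAdd i j < Fin.castAdd m k := fun j k =>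
    (h1 k j).not_gt
  have h3 : ∀ j k : Fin i, Fin.castAdd m j < Fin.castAdd m k ↔ j < k := fun j k => Iff.rfl
  have h4 : ∀ j k : Fin m, Fin.natAdd i j < Fin.natAdd i k ↔ j < k := fun j k => by
    rw [Fin.lt_def, Fin.lt_def]; simp
  simp only [wordLength, wordInv, wordNegPairs, wordNeg, crossLength, Fin.sum_univ_add, h1, h2,
    h3, h4, Function.comp, true_and, false_and, if_false, Finset.sum_add_distrib,
    Finset.sum_const_zero]
  rw [Finset.sum_comm (s := (univ : Finset (Fin m))) (t := (univ : Finset (Fin i))),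
    Finset.sum_comm (s := (univ : Finset (Fin m))) (t := (univ : Finset (Fin i)))]
  ring

lemma two_mul_sum_lt_add_diag {m : ℕ} (g : Fin m → Fin m → ℕ) (hg : ∀ j k, g j k = g k j) :
    2 * (∑ j, ∑ k, if j < k then g j k else 0) + ∑ j, g j j = ∑ j, ∑ k, g j k := by
  have h : ∀ j k, g j k = (if j < k then g j k else 0) + (if k < j then g k j else 0) +
      if j = k then g j j else 0 := by
    intro j k
    rcases lt_trichotomy j k with h | rfl | h
    · simp [h, h.not_gt, h.ne]
    · simp
    · simp [h, h.not_gt, h.ne', hg j k]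
  have h' : ∑ j, ∑ k, g j k = ∑ j, ∑ k, ((if j < k then g j k else 0) +
      (if k < j then g k j else 0) + if j = k then g j j else 0) :=
    Finset.sum_congr rfl fun j _ => Finset.sum_congr rfl fun k _ => h j k
  rw [h']
  simp only [Finset.sum_add_distrib]
  rw [Finset.sum_comm (f := fun j k => if k < j then g k j else 0)]
  simp
  ring

lemma wordNegPairs_comp_perm {m : ℕ} (y : Fin m → ℤ) (v : Equiv.Perm (Fin m)) :
    wordNegPairs (y ∘ v) = wordNegPairs y := by
  have key : ∀ x : Fin m → ℤ, 2 * wordNegPairs x + ∑ j, (if x j < -x j then 1 else 0) =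
      ∑ j, ∑ k, if x k < -x j then 1 else 0 := by
    intro x
    rw [← two_mul_sum_lt_add_diag (fun j k => if x k < -x j then 1 else 0)
      fun j k => if_congr (by omega) rfl rfl]
    simp only [wordNegPairs, ite_and]
  have h1 := key (y ∘ v)
  have h2 := key y
  have h3 : ∑ j, (if (y ∘ v) j < -(y ∘ v) j then 1 else 0) = ∑ j, if y j < -y j then 1 else 0 :=
    Equiv.sum_comp v fun j => if y j < -y j then 1 else 0
  have h4 : (∑ j, ∑ k, if (y ∘ v) k < -(y ∘ v) j then 1 else 0) =
      ∑ j, ∑ k, if y k < -y j then 1 else 0 := by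
    rw [← Equiv.sum_comp v fun j => ∑ k, if y k < -y j then 1 else 0]
    exact Finset.sum_congr rfl fun j _ => Equiv.sum_comp v fun k => if y k < -y (v j) then 1 else 0
  omega

lemma crossLength_signedAct_comp {i m : ℕ} (x : Fin i → ℤ) (y : Fin m → ℤ) (u : BG i)
    (v : Equiv.Perm (Fin m)) : crossLength (signedAct x u) (y ∘ v) = crossLength x y := by
  have h1 : wordNeg (y ∘ v) = wordNeg y := Equiv.sum_comp v fun j => if y j < 0 then 1 else 0
  rw [crossLength, crossLength, wordNegPairs_comp_perm, h1]
  congr 2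
  rw [← Equiv.sum_comp v fun k =>
    ∑ j, ((if y k < x j then 1 else 0) + if y k < -x j then 1 else 0)]
  refine Finset.sum_congr rfl fun k _ => ?_
  rw [← Equiv.sum_comp u.1 fun j =>
    ((if y (v k) < x j then 1 else 0) + if y (v k) < -x j then 1 else 0)]
  refine Finset.sum_congr rfl fun j _ => ?_
  simp only [signedAct, boolSign, Function.comp]
  by_cases hu : u.2 j = true <;> simp [hu, add_comm]

/-- The embedding of `𝔅_i × 𝔖_m` as a parabolic subgroup of `𝔅_{i+m}`. -/
def blockEmb {i m : ℕ} (u : BG i) (v : Equiv.Perm (Fin m)) : BG (i + m) :=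
  (finSumFinEquiv.permCongr (Equiv.sumCongr u.1 v), Fin.append u.2 fun _ => false)

lemma signedWord_mul_blockEmb_castAdd {i m : ℕ} (w : BG (i + m)) (u : BG i)
    (v : Equiv.Perm (Fin m)) : signedWord (signedMul w (blockEmb u v)) ∘ Fin.castAdd m =
      signedAct (signedWord w ∘ Fin.castAdd m) u := by
  rw [signedWord, signedAct_mul]
  funext j
  simp [signedAct, blockEmb, signedWord, Equiv.permCongr_apply]

lemma signedWord_mul_blockEmb_natAdd {i m : ℕ} (w : BG (i + m)) (u : BG i)
    (v : Equiv.Perm (Fin m)) : signedWord (signedMul w (blockEmb u v)) ∘ Fin.natAdd i =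
      (signedWord w ∘ Fin.natAdd i) ∘ v := by
  rw [signedWord, signedAct_mul]
  funext j
  simp [signedAct, blockEmb, signedWord, Equiv.permCongr_apply, boolSign]

/-- Averaging over the parabolic subgroup `𝔅_i × 𝔖_m`: statistics of the two blocks and the
cross length are independent. -/
lemma card_mul_sum_blocks {A : Type*} [CommRing A] {i m : ℕ} (F₁ : (Fin i → ℤ) → A)
    (F₂ : (Fin m → ℤ) → A) (P₁ P₂ q : A)
    (h₁ : ∀ a, IsSignedWord a → ∑ u : BG i, F₁ (signedAct a u) = P₁)
    (h₂ : ∀ b, Function.Injective b → ∑ v : Equiv.Perm (Fin m), F₂ (b ∘ v) = P₂) :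
    (Fintype.card (BG i × Equiv.Perm (Fin m)) : A) *
      ∑ w : BG (i + m), F₁ (signedWord w ∘ Fin.castAdd m) * F₂ (signedWord w ∘ Fin.natAdd i) *
        q ^ crossLength (signedWord w ∘ Fin.castAdd m) (signedWord w ∘ Fin.natAdd i) =
    (∑ w : BG (i + m),
      q ^ crossLength (signedWord w ∘ Fin.castAdd m) (signedWord w ∘ Fin.natAdd i)) *
        (P₁ * P₂) := by
  set S : BG (i + m) → A := fun w =>
    F₁ (signedWord w ∘ Fin.castAdd m) * F₂ (signedWord w ∘ Fin.natAdd i) *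
      q ^ crossLength (signedWord w ∘ Fin.castAdd m) (signedWord w ∘ Fin.natAdd i) with hS
  have hcard : (Fintype.card (BG i × Equiv.Perm (Fin m)) : A) * ∑ w, S w =
      ∑ h : BG i × Equiv.Perm (Fin m), ∑ w, S (signedMul w (blockEmb h.1 h.2)) := by
    have h : ∀ h : BG i × Equiv.Perm (Fin m), ∑ w, S (signedMul w (blockEmb h.1 h.2)) =
        ∑ w, S w := fun h => (signedMul_left_bijective (blockEmb h.1 h.2)).sum_comp S
    simp only [h, Finset.sum_const, Finset.card_univ, nsmul_eq_mul]
  rw [hcard, Finset.sum_comm, Finset.sum_mul]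
  refine Finset.sum_congr rfl fun w _ => ?_
  simp only [hS, signedWord_mul_blockEmb_castAdd, signedWord_mul_blockEmb_natAdd,
    crossLength_signedAct_comp]
  rw [← Finset.sum_mul, mul_comm, Fintype.sum_prod_type,
    ← h₁ _ ((isSignedWord_signedWord w).comp (Fin.castAdd_injective i m)),
    ← h₂ _ ((isSignedWord_signedWord w).comp (Fin.natAdd_injective m i)).injective,
    Finset.sum_mul_sum]

lemma wordInv_succ {n : ℕ} (x : Fin (n + 1) → ℤ) :
    wordInv x = (∑ k : Fin n, if x k.succ < x 0 then 1 else 0) + wordInv (x ∘ Fin.succ) := by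
  simp only [wordInv, Fin.sum_univ_succ, Function.comp, Fin.succ_pos, Fin.succ_lt_succ_iff,
    Fin.not_lt_zero, true_and, false_and, if_false, zero_add]

lemma sum_perm_pow_wordInv {A : Type*} [CommRing A] (n : ℕ) (q : A) :
    ∑ v : Equiv.Perm (Fin n), q ^ wordInv (fun j => ((v j : ℕ) : ℤ)) = qFact n q := by
  induction n with
  | zero => simp [qFact, wordInv]
  | succ n ih =>
    have hfirst : ∀ v : Equiv.Perm (Fin (n + 1)),
        (∑ k : Fin n, if ((v k.succ : ℕ) : ℤ) < ((v 0 : ℕ) : ℤ) then 1 else 0) = (v 0 : ℕ) := by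
      intro v
      have h1 := Equiv.sum_comp v fun k => if ((k : ℕ) : ℤ) < ((v 0 : ℕ) : ℤ) then 1 else 0
      rw [Fin.sum_univ_succ, if_neg (lt_irrefl _), zero_add] at h1
      rw [h1, ← Finset.card_filter]
      have : (univ.filter fun k : Fin (n + 1) => ((k : ℕ) : ℤ) < ((v 0 : ℕ) : ℤ)) =
          Finset.Iio (v 0) := by
        ext k
        simp
      rw [this, Fin.card_Iio]
    have hfirst' : ∀ (p : Fin (n + 1)) (e : Equiv.Perm (Fin n)),
        (∑ k : Fin n, if ((Equiv.Perm.decomposeFin.symm (p, e) k.succ : ℕ) : ℤ) < ((p : ℕ) : ℤ)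
          then 1 else 0) = (p : ℕ) := by
      intro p e
      simpa only [Equiv.Perm.decomposeFin_symm_apply_zero] using
        hfirst (Equiv.Perm.decomposeFin.symm (p, e))
    rw [← Equiv.sum_comp Equiv.Perm.decomposeFin.symm, Fintype.sum_prod_type]
    simp only [wordInv_succ, hfirst', pow_add, Equiv.Perm.decomposeFin_symm_apply_zero,
      ← Finset.mul_sum]
    have hrest : ∀ p : Fin (n + 1), ∑ e : Equiv.Perm (Fin n), q ^ wordInv
        ((fun j => ((Equiv.Perm.decomposeFin.symm (p, e) j : ℕ) : ℤ)) ∘ Fin.succ) =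
          qFact n q := by
      intro p
      rw [← ih, ← sum_perm_comp (fun x => q ^ wordInv x) (fun x y h => by rw [wordInv_congr h])
        (b := fun k => ((Equiv.swap 0 p k.succ : ℕ) : ℤ))]
      · refine Finset.sum_congr rfl fun e _ => ?_
        congr 2
        funext k
        simp
      · intro j k hjk
        have : Equiv.swap 0 p j.succ = Equiv.swap 0 p k.succ := Fin.ext (by simpa using hjk)
        simpa using this
    simp only [hrest, ← Finset.sum_mul]
    have hq : qFact (n + 1) q = qFact n q * qInt (n + 1) q := Finset.prod_range_succ _ _
    rw [hq, mul_comm, qInt, Fin.sum_univ_eq_sum_range fun k => q ^ k]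

lemma sum_perm_strictMono {A : Type*} [CommRing A] {m : ℕ} {b : Fin m → ℤ}
    (hb : Function.Injective b) [DecidablePred (StrictMono : (Fin m → ℤ) → Prop)] :
    ∑ v : Equiv.Perm (Fin m), (if StrictMono (b ∘ v) then (1 : A) else 0) = 1 := by
  obtain ⟨v₀, h₀⟩ := exists_strictMono_comp hb
  rw [Finset.sum_eq_single v₀, if_pos h₀]
  · intro v _ hv
    refine if_neg fun h => hv ?_
    refine Equiv.ext fun j => hb ?_
    refine congrFun ((h.range_inj h₀).mp ?_) j
    rw [v.surjective.range_comp, v₀.surjective.range_comp]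
  · simp

/-- The number of even descents of a sequence below position `n`. -/
def evenDes (n : ℕ) (f : ℕ → ℤ) : ℕ := ((range n).filter fun k => Even k ∧ f (k + 1) < f k).card

/-- The number of odd descents of a sequence below position `n`. -/
def oddDes (n : ℕ) (f : ℕ → ℤ) : ℕ := ((range n).filter fun k => Odd k ∧ f (k + 1) < f k).card

lemma evenDes_congr {n : ℕ} {f g : ℕ → ℤ}
    (h : ∀ k < n, f (k + 1) < f k ↔ g (k + 1) < g k) : evenDes n f = evenDes n g := by
  unfold evenDes
  congr 1
  exact Finset.filter_congr fun k hk => by rw [h k (mem_range.mp hk)]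

lemma oddDes_congr {n : ℕ} {f g : ℕ → ℤ}
    (h : ∀ k < n, f (k + 1) < f k ↔ g (k + 1) < g k) : oddDes n f = oddDes n g := by
  unfold oddDes
  congr 1
  exact Finset.filter_congr fun k hk => by rw [h k (mem_range.mp hk)]

lemma SameSignedPattern.wordExt_lt_iff {n : ℕ} {x y : Fin n → ℤ} (h : SameSignedPattern x y)
    (j k : ℕ) : wordExt x j < wordExt x k ↔ wordExt y j < wordExt y k := by
  obtain ⟨h1, -, h3, h4⟩ := h
  unfold wordExt
  split_ifs <;> simp [h1, h3, h4]

/-- The weight of a word: its descents in positions `0, …, n - 1` and its length. -/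
def wordWeight {A : Type*} [CommRing A] {n : ℕ} (s t q : A) (x : Fin n → ℤ) : A :=
  s ^ evenDes n (wordExt x) * t ^ oddDes n (wordExt x) * q ^ wordLength x

lemma wordWeight_congr {A : Type*} [CommRing A] {n : ℕ} (s t q : A) {x y : Fin n → ℤ}
    (h : SameSignedPattern x y) : wordWeight s t q x = wordWeight s t q y := by
  rw [wordWeight, wordWeight, wordLength_congr h, evenDes_congr fun k _ => h.wordExt_lt_iff _ _,
    oddDes_congr fun k _ => h.wordExt_lt_iff _ _]

lemma sum_wordWeight_signedAct {A : Type*} [CommRing A] {n : ℕ} (s t q : A) {a : Fin n → ℤ}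
    (ha : IsSignedWord a) : ∑ u : BG n, wordWeight s t q (signedAct a u) = Bpoly n s t q := by
  rw [sum_signedAct _ (fun x y => wordWeight_congr s t q) ha]
  exact Finset.sum_congr rfl fun u _ => by rw [invB_eq_wordLength]; rfl

lemma wordInv_eq_zero {n : ℕ} {x : Fin n → ℤ} (hx : StrictMono x) : wordInv x = 0 := by
  refine Finset.sum_eq_zero fun j _ => Finset.sum_eq_zero fun k _ => if_neg ?_
  rintro ⟨h1, h2⟩
  exact (hx h1).not_gt h2

open Classical in
/-- The factorization over minimal coset representatives, with the descents in the
positions `≥ i` ignored. -/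
lemma sum_increasing_tail {A : Type*} [CommRing A] [IsDomain A] [CharZero A] (i m : ℕ)
    (s t q : A) :
    BOne i q * qFact m q * ∑ w : BG (i + m) with StrictMono (signedWord w ∘ Fin.natAdd i),
      s ^ evenDes i (bval w) * t ^ oddDes i (bval w) * q ^ invB w =
        Bpoly i s t q * BOne (i + m) q := by
  have hB : Bpoly i 1 1 q = BOne i q := by simp [Bpoly, BOne]
  have h1 := card_mul_sum_blocks (i := i) (m := m) (wordWeight 1 1 q) (fun y => q ^ wordInv y)
    (BOne i q) (qFact m q) q (fun a ha => by rw [sum_wordWeight_signedAct _ _ _ ha, hB])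
    fun b hb => by
      rw [← sum_perm_pow_wordInv]
      exact sum_perm_comp (fun x => q ^ wordInv x) (fun x y h => by rw [wordInv_congr h]) hb
  have h2 := card_mul_sum_blocks (i := i) (m := m) (wordWeight s t q)
    (fun y => if StrictMono y then 1 else 0) (Bpoly i s t q) 1 q
    (fun a ha => sum_wordWeight_signedAct _ _ _ ha) fun b hb => sum_perm_strictMono hb
  have e1 : ∑ w : BG (i + m), wordWeight 1 1 q (signedWord w ∘ Fin.castAdd m) *
      q ^ wordInv (signedWord w ∘ Fin.natAdd i) *
        q ^ crossLength (signedWord w ∘ Fin.castAdd m) (signedWord w ∘ Fin.natAdd i) =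
      BOne (i + m) q := by
    refine Finset.sum_congr rfl fun w _ => ?_
    rw [invB_eq_wordLength, wordLength_eq_add_crossLength, wordWeight]
    ring
  have e2 : ∑ w : BG (i + m), wordWeight s t q (signedWord w ∘ Fin.castAdd m) *
      (if StrictMono (signedWord w ∘ Fin.natAdd i) then 1 else 0) *
        q ^ crossLength (signedWord w ∘ Fin.castAdd m) (signedWord w ∘ Fin.natAdd i) =
      ∑ w : BG (i + m) with StrictMono (signedWord w ∘ Fin.natAdd i),
        s ^ evenDes i (bval w) * t ^ oddDes i (bval w) * q ^ invB w := by
    rw [Finset.sum_filter]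
    refine Finset.sum_congr rfl fun w _ => ?_
    split_ifs with hw
    · have hd : ∀ k < i, wordExt (signedWord w ∘ Fin.castAdd m) (k + 1) <
          wordExt (signedWord w ∘ Fin.castAdd m) k ↔ bval w (k + 1) < bval w k := fun k hk => by
        rw [wordExt_comp_castAdd _ (by omega), wordExt_comp_castAdd _ (by omega),
          bval_eq_wordExt]
      rw [invB_eq_wordLength, wordLength_eq_add_crossLength, wordInv_eq_zero hw, wordWeight,
        evenDes_congr hd, oddDes_congr hd]
      ring
    · ring
  rw [e1] at h1
  rw [e2] at h2
  have hN : (Fintype.card (BG i × Equiv.Perm (Fin m)) : A) ≠ 0 :=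
    Nat.cast_ne_zero.mpr Fintype.card_ne_zero
  refine mul_left_cancel₀ hN ?_
  linear_combination BOne i q * qFact m q * h2 - Bpoly i s t q * h1

lemma mem_Gset_iff_strictMono {i m : ℕ} (hm : 0 < m) (w : BG (i + m)) :
    w ∈ Gset (i + m) i ↔ StrictMono (signedWord w ∘ Fin.natAdd i) := by
  obtain ⟨m, rfl⟩ := Nat.exists_eq_succ_of_ne_zero hm.ne'
  have hval : ∀ k : Fin (m + 1), (signedWord w ∘ Fin.natAdd i) k = bval w (i + k + 1) := by
    intro k
    rw [bval_eq_wordExt]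
    exact (wordExt_succ (signedWord w) (Fin.natAdd i k)).symm
  rw [Fin.strictMono_iff_lt_succ]
  simp only [Gset, mem_filter, mem_univ, true_and, hval, Fin.val_castSucc, Fin.val_succ]
  constructor
  · intro h k
    exact h (i + k + 1) (by omega) (by push_cast; omega)
  · intro h j hj hij
    obtain ⟨k, rfl⟩ : ∃ k, j = i + k + 1 := ⟨j - (i + 1), by omega⟩
    exact h ⟨k, by omega⟩

lemma mem_Gset_sub_one_iff {n i : ℕ} (hi : i < n) (w : BG n) :
    w ∈ Gset n ((i : ℤ) - 1) ↔ w ∈ Gset n i ∧ bval w i < bval w (i + 1) := by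
  simp only [Gset, mem_filter, mem_univ, true_and]
  constructor
  · exact fun h => ⟨fun j hj hij => h j hj (by omega), h i hi (by omega)⟩
  · rintro ⟨h, hi'⟩ j hj hij
    rcases (show i ≤ j by omega).eq_or_lt with rfl | hlt
    · exact hi'
    · exact h j hj (by omega)

lemma bval_ne_bval_succ {n i : ℕ} (hi : i < n) (w : BG n) : bval w i ≠ bval w (i + 1) := by
  have hw := isSignedWord_signedWord w
  have h1 : bval w (i + 1) = signedWord w ⟨i, hi⟩ := wordExt_succ (signedWord w) ⟨i, hi⟩
  rw [h1]
  rcases i with - | i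
  · exact (hw.1 _).symm
  · have h0 : bval w (i + 1) = signedWord w ⟨i, by omega⟩ :=
      wordExt_succ (signedWord w) ⟨i, by omega⟩
    rw [h0]
    exact fun h => by simpa using hw.injective h

lemma card_filter_range_of_forall_not {n i : ℕ} (hi : i < n) (p : ℕ → Prop) [DecidablePred p]
    (h : ∀ j, i < j → j < n → ¬ p j) :
    ((range n).filter p).card = ((range i).filter p).card + if p i then 1 else 0 := by
  have : (range n).filter p = (range (i + 1)).filter p := by
    ext j
    simp only [mem_filter, mem_range, and_congr_left_iff]
    intro hj
    by_contra hne
    exact h j (by omega) (by omega) hj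
  rw [this, Finset.card_filter, Finset.sum_range_succ, ← Finset.card_filter]

lemma edesB_of_mem_Gset {n i : ℕ} (hi : i < n) {w : BG n} (hw : w ∈ Gset n i) :
    edesB w = evenDes i (bval w) + if Even i ∧ bval w (i + 1) < bval w i then 1 else 0 :=
  card_filter_range_of_forall_not hi _ fun j hij hj h =>
    ((mem_filter.mp hw).2 j hj (by omega)).not_gt h.2

lemma odesB_of_mem_Gset {n i : ℕ} (hi : i < n) {w : BG n} (hw : w ∈ Gset n i) :
    odesB w = oddDes i (bval w) + if Odd i ∧ bval w (i + 1) < bval w i then 1 else 0 :=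
  card_filter_range_of_forall_not hi _ fun j hij hj h =>
    ((mem_filter.mp hw).2 j hj (by omega)).not_gt h.2

/-- Splitting `G_{n,i}` according to whether there is a descent in position `i`. -/
lemma W_Gset_eq {n i : ℕ} (hi : i < n) {x : K} (hx : x = if Even i then sK else tK) :
    W (Gset n i) = x * ∑ w ∈ Gset n i,
        sK ^ evenDes i (bval w) * tK ^ oddDes i (bval w) * qK ^ invB w
      + (1 - x) * W (Gset n ((i : ℤ) - 1)) := by
  have hG : Gset n ((i : ℤ) - 1) = (Gset n i).filter fun w => bval w i < bval w (i + 1) := by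
    ext w
    rw [mem_Gset_sub_one_iff hi, mem_filter]
  rw [hG, W, W, Finset.sum_filter, Finset.mul_sum, Finset.mul_sum, ← Finset.sum_add_distrib]
  refine Finset.sum_congr rfl fun w hw => ?_
  rw [edesB_of_mem_Gset hi hw, odesB_of_mem_Gset hi hw, hx]
  rcases (bval_ne_bval_succ hi w).lt_or_gt with h | h
  · simp only [h, h.not_gt, and_false, if_false, if_true, add_zero]
    ring
  · by_cases he : Even i
    · simp only [h, h.not_gt, he, Nat.not_odd_iff_even.mpr he, and_true, if_false, if_true]
      ring
    · simp only [h, h.not_gt, he, Nat.not_even_iff_odd.mp he, and_true, if_false, if_true]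
      ring

lemma Gset_recursion {n i : ℕ} (hi : i < n) {x : K} (hx : x = if Even i then sK else tK) :
    BOne i qK * qFact (n - i) qK * W (Gset n (i : ℤ)) =
      x * Bpoly i sK tK qK * BOne n qK
        + (1 - x) * (BOne i qK * qFact (n - i) qK * W (Gset n ((i : ℤ) - 1))) := by
  classical
  obtain ⟨m, rfl⟩ := Nat.exists_eq_add_of_lt hi
  have hG : (univ.filter fun w : BG (i + (m + 1)) =>
      StrictMono (signedWord w ∘ Fin.natAdd i)) = Gset (i + (m + 1)) i := by
    ext w
    rw [mem_Gset_iff_strictMono (Nat.succ_pos m)]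
    simp
  have h := sum_increasing_tail i (m + 1) sK tK qK
  have hW := W_Gset_eq hi hx
  rw [show i + m + 1 - i = m + 1 by omega]
  rw [show i + m + 1 = i + (m + 1) from rfl] at hW ⊢
  rw [← hG] at hW
  rw [← hG]
  linear_combination BOne i qK * qFact (m + 1) qK * hW + x * h

end SignedWords

theorem typeB_run_recursion (n : ℕ) (hn : 1 ≤ n) (i : ℕ) (hi : i ≤ n - 1) :
    (Odd i →
      BOne i qK * qFact (n - i) qK * W (Gset n (i : ℤ)) =
        tK * Bpoly i sK tK qK * BOne n qK
          + (1 - tK) * (BOne i qK * qFact (n - i) qK * W (Gset n ((i : ℤ) - 1))))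
    ∧
    (Even i →
      BOne i qK * qFact (n - i) qK * W (Gset n (i : ℤ)) =
        sK * Bpoly i sK tK qK * BOne n qK
          + (1 - sK) * (BOne i qK * qFact (n - i) qK * W (Gset n ((i : ℤ) - 1)))) := by
  have hin : i < n := by omega
  exact ⟨fun h => Gset_recursion hin (if_neg (Nat.not_even_iff_odd.mpr h)).symm,
    fun h => Gset_recursion hin (if_pos h).symm⟩

end
end
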